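/- Let r > 1, κ ∈ ℝ, and let λ be a mask of type (r,κ), and define J_m(λ) := ∫_{|x| ≥ m} ( |λ(x)|/m + |x λ''(x)| ) dx. Then there is a constant a₄ > 0 such that J_m(λ) ≤ a₄ m^{-r} (log(m+1))^{-κ} for all m ≥ 1. -/

import Mathlib

open Real MeasureTheory

/-- `lam` is a mask of type `(r, κ)` with constant `a₁` witnessed by `F`. -/
def IsMask (r κ : ℝ) (lam : ℝ → ℝ) : Prop :=
  (∀ x : ℝ, lam (-x) = lam x) ∧ ContDiff ℝ 2 lam ∧
    ∃ (F : ℝ → ℝ) (a₁ : ℝ), ContDiff ℝ 2 F ∧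
      (∀ t : ℝ, 1 ≤ t → lam t = t ^ (-r) * (Real.log (t + 1)) ^ (-κ) * F (Real.log t)) ∧
      (∀ t : ℝ, 1 ≤ t → ∀ k : ℕ, k ≤ 2 → |iteratedDeriv k F t| ≤ a₁)

/-- The tail quantity `J_m(λ) := ∫_{|x| ≥ m} (|λ(x)|/m + |x λ''(x)|) dx`. -/
noncomputable def Jm (lam : ℝ → ℝ) (m : ℕ) : ℝ :=
  ∫ x in {x : ℝ | (m : ℝ) ≤ |x|}, (|lam x| / m + |x * deriv (deriv lam) x|)

/-- The building block `t ^ a * log (t + 1) ^ b * (t + 1) ^ c * G (log t)`; such functions span a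
space closed under differentiation. -/
noncomputable def powLogTerm (a b c : ℝ) (G : ℝ → ℝ) (t : ℝ) : ℝ :=
  t ^ a * Real.log (t + 1) ^ b * (t + 1) ^ c * G (Real.log t)

theorem hasDerivAt_powLogTerm {a b c t : ℝ} {G G' : ℝ → ℝ} (ht : 0 < t)
    (hG : ∀ u, HasDerivAt G (G' u) u) :
    HasDerivAt (powLogTerm a b c G)
      (powLogTerm (a - 1) b c (fun u => a * G u + G' u) t +
        powLogTerm a (b - 1) (c - 1) (fun u => b * G u) t +
        powLogTerm a b (c - 1) (fun u => c * G u) t) t := by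
  have ht1 : 0 < t + 1 := by linarith
  have hL : 0 < Real.log (t + 1) := Real.log_pos (by linarith)
  have h1 : HasDerivAt (fun t : ℝ => t ^ a) (a * t ^ (a - 1)) t :=
    Real.hasDerivAt_rpow_const (Or.inl ht.ne')
  have hs : HasDerivAt (fun t : ℝ => t + 1) 1 t := (hasDerivAt_id t).add_const 1
  have h2 := (hs.log ht1.ne').rpow_const (p := b) (Or.inl hL.ne')
  have h3 := hs.rpow_const (p := c) (Or.inl ht1.ne')
  have h4 := (hG (Real.log t)).comp t (Real.hasDerivAt_log ht.ne')
  refine (((h1.mul h2).mul h3).mul h4).congr_deriv ?_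
  simp only [powLogTerm, Pi.mul_apply, Function.comp]
  rw [Real.rpow_sub_one ht.ne', Real.rpow_sub_one ht1.ne', Real.rpow_sub_one hL.ne']
  field_simp
  ring

theorem powLogTerm_bound {a b c κ : ℝ} {G : ℝ → ℝ} (hc : c ≤ 0) (hb : b ≤ -κ)
    (hG : ∃ B, ∀ u, 0 ≤ u → |G u| ≤ B) :
    ∃ C, ∀ t, 1 ≤ t →
      |powLogTerm a b c G t| ≤ C * (t ^ (a + c) * Real.log (t + 1) ^ (-κ)) := by
  obtain ⟨B, hB⟩ := hG
  refine ⟨Real.log 2 ^ (b + κ) * B, fun t ht => ?_⟩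
  have ht0 : 0 < t := by linarith
  have hl2 : 0 < Real.log 2 := Real.log_pos (by norm_num)
  have hL2 : Real.log 2 ≤ Real.log (t + 1) := Real.log_le_log (by norm_num) (by linarith)
  have hL : 0 < Real.log (t + 1) := hl2.trans_le hL2
  have e1 : Real.log (t + 1) ^ b ≤ Real.log 2 ^ (b + κ) * Real.log (t + 1) ^ (-κ) := by
    calc Real.log (t + 1) ^ b = Real.log (t + 1) ^ (b + κ) * Real.log (t + 1) ^ (-κ) := by
          rw [← Real.rpow_add hL]; ring_nf
      _ ≤ _ := by
          gcongr ?_ * _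
          exact Real.rpow_le_rpow_of_nonpos hl2 hL2 (by linarith)
  have e2 : (t + 1) ^ c ≤ t ^ c := Real.rpow_le_rpow_of_nonpos ht0 (by linarith) hc
  have e3 := hB (Real.log t) (Real.log_nonneg ht)
  have ha : 0 ≤ t ^ a * Real.log (t + 1) ^ b * (t + 1) ^ c := by positivity
  rw [powLogTerm, abs_mul, abs_of_nonneg ha]
  calc t ^ a * Real.log (t + 1) ^ b * (t + 1) ^ c * |G (Real.log t)|
      ≤ t ^ a * (Real.log 2 ^ (b + κ) * Real.log (t + 1) ^ (-κ)) * t ^ c * B := by gcongr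
    _ = _ := by rw [Real.rpow_add ht0]; ring

theorem log_add_one_rpow_le (κ : ℝ) {δ : ℝ} (hδ : 0 < δ) :
    ∃ C > 0, ∀ m t : ℝ, 1 ≤ m → m ≤ t →
      Real.log (t + 1) ^ (-κ) ≤ C * ((t / m) ^ δ * Real.log (m + 1) ^ (-κ)) := by
  have hl2 : 0 < Real.log 2 := Real.log_pos (by norm_num)
  have hLm {m : ℝ} (hm : 1 ≤ m) : Real.log 2 ≤ Real.log (m + 1) :=
    Real.log_le_log (by norm_num) (by linarith)
  rcases le_or_gt 0 κ with hκ | hκ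
  · refine ⟨1, one_pos, fun m t hm hmt => ?_⟩
    have hL := hl2.trans_le (hLm hm)
    have hu : 1 ≤ (t / m) ^ δ :=
      Real.one_le_rpow ((one_le_div (by linarith)).2 hmt) hδ.le
    have h := Real.rpow_le_rpow_of_nonpos hL
      (Real.log_le_log (by linarith) (by linarith : m + 1 ≤ t + 1)) (by linarith : -κ ≤ 0)
    rw [one_mul]
    exact h.trans (le_mul_of_one_le_left (by positivity) hu)
  · obtain ⟨p, rfl⟩ : ∃ p, κ = -p := ⟨-κ, by ring⟩
    rw [neg_neg]
    have hp : 0 < p := by linarith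
    have hε : 0 < δ / p := by positivity
    refine ⟨(1 + 1 / (δ / p * Real.log 2)) ^ p, by positivity, fun m t hm hmt => ?_⟩
    have hm0 : 0 < m := by linarith
    have ht0 : 0 < t := by linarith
    have hL := hl2.trans_le (hLm hm)
    have hLt := hl2.trans_le (hLm (hm.trans hmt))
    have hu1 : 1 ≤ t / m := (one_le_div hm0).2 hmt
    have hu : 1 ≤ (t / m) ^ (δ / p) := Real.one_le_rpow hu1 hε.le
    have key : Real.log (t + 1) ≤
        (1 + 1 / (δ / p * Real.log 2)) * ((t / m) ^ (δ / p) * Real.log (m + 1)) := by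
      calc Real.log (t + 1) ≤ Real.log (t / m * (m + 1)) := by
            refine Real.log_le_log (by linarith) ?_
            have : t / m * (m + 1) = t + t / m := by field_simp
            linarith
        _ = Real.log (m + 1) * 1 + Real.log (t / m) * 1 := by
            rw [Real.log_mul (by positivity) (by positivity)]; ring
        _ ≤ Real.log (m + 1) * (t / m) ^ (δ / p) +
            (t / m) ^ (δ / p) / (δ / p) * (Real.log (m + 1) / Real.log 2) := by
            gcongr
            · exact Real.log_le_rpow_div (by linarith) hε
            · exact (one_le_div hl2).2 (hLm hm)
        _ = _ := by field_simp
    calc Real.log (t + 1) ^ p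
        ≤ ((1 + 1 / (δ / p * Real.log 2)) * ((t / m) ^ (δ / p) * Real.log (m + 1))) ^ p := by
          gcongr
      _ = _ := by
          rw [Real.mul_rpow (by positivity) (by positivity),
            Real.mul_rpow (by positivity) (by positivity), ← Real.rpow_mul (by positivity),
            div_mul_cancel₀ _ hp.ne']

theorem exists_abs_bound_of_eventual {G : ℝ → ℝ} {B : ℝ} (hG : Continuous G)
    (hB : ∀ u, 1 ≤ u → |G u| ≤ B) : ∃ B', ∀ u, 0 ≤ u → |G u| ≤ B' := by
  obtain ⟨A, hA⟩ := (isCompact_Icc (a := (0 : ℝ)) (b := 1)).exists_bound_of_continuousOn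
    hG.continuousOn
  refine ⟨max A B, fun u hu => ?_⟩
  rcases le_total u 1 with h | h
  · exact (hA u ⟨hu, h⟩).trans (le_max_left _ _)
  · exact (hB u h).trans (le_max_right _ _)

theorem IsMask.bounds {r κ : ℝ} {lam : ℝ → ℝ} (hlam : IsMask r κ lam) :
    ∃ C, 0 < C ∧ ∀ t, 1 < t →
      |lam t| ≤ C * (t ^ (-r) * Real.log (t + 1) ^ (-κ)) ∧
      |deriv (deriv lam) t| ≤ C * (t ^ (-r - 2) * Real.log (t + 1) ^ (-κ)) := by
  obtain ⟨-, -, F, a₁, hF, hlamF, hb⟩ := hlam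
  have hF1 : ∀ u, HasDerivAt F (deriv F u) u := fun u =>
    (hF.differentiable (by norm_num) u).hasDerivAt
  have hdF : ContDiff ℝ 1 (deriv F) := hF.deriv' (n := 1)
  have hF2 : ∀ u, HasDerivAt (deriv F) (deriv (deriv F) u) u := fun u =>
    (hdF.differentiable (by norm_num) u).hasDerivAt
  obtain ⟨B0, hB0⟩ := exists_abs_bound_of_eventual hF.continuous
    fun u hu => by simpa using hb u hu 0 (by norm_num)
  obtain ⟨B1, hB1⟩ := exists_abs_bound_of_eventual hdF.continuous
    fun u hu => by simpa [iteratedDeriv_one] using hb u hu 1 (by norm_num)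
  obtain ⟨B2, hB2⟩ := exists_abs_bound_of_eventual (hdF.continuous_deriv le_rfl)
    fun u hu => by simpa [iteratedDeriv_succ] using hb u hu 2 (by norm_num)
  have comb (α β γ : ℝ) : ∃ B, ∀ u, 0 ≤ u →
      |α * F u + β * deriv F u + γ * deriv (deriv F) u| ≤ B := by
    refine ⟨|α| * B0 + |β| * B1 + |γ| * B2, fun u hu => (abs_add_three _ _ _).trans ?_⟩
    simp only [abs_mul]
    gcongr
    exacts [hB0 u hu, hB1 u hu, hB2 u hu]
  have hlam_eq : ∀ t, 1 < t → lam t = powLogTerm (-r) (-κ) 0 F t := fun t ht => by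
    rw [hlamF t ht.le]; simp [powLogTerm]
  have hd1 : ∀ t, 1 < t → deriv lam t =
      powLogTerm (-r - 1) (-κ) 0 (fun u => -r * F u + deriv F u) t +
      powLogTerm (-r) (-κ - 1) (-1) (fun u => -κ * F u) t := fun t ht => by
    rw [Filter.EventuallyEq.deriv_eq ((eventually_gt_nhds ht).mono hlam_eq),
      (hasDerivAt_powLogTerm (by linarith) hF1).deriv]
    simp [powLogTerm]
  have term (a b c : ℝ) (G : ℝ → ℝ) (α β γ : ℝ) (hc : c ≤ 0) (hb : b ≤ -κ)
      (hG : G = fun u => α * F u + β * deriv F u + γ * deriv (deriv F) u) :=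
    powLogTerm_bound (a := a) (G := G) hc hb (by rw [hG]; exact comb α β γ)
  obtain ⟨C0, h0⟩ := term (-r) (-κ) 0 F 1 0 0 le_rfl le_rfl (by simp)
  obtain ⟨C1, h1⟩ := term (-r - 1 - 1) (-κ) 0
    (fun u => (-r - 1) * (-r * F u + deriv F u) + (-r * deriv F u + deriv (deriv F) u))
    ((-r - 1) * -r) ((-r - 1) + -r) 1 le_rfl le_rfl (by ext; ring)
  obtain ⟨C2, h2⟩ := term (-r - 1) (-κ - 1) (0 - 1)
    (fun u => -κ * (-r * F u + deriv F u)) (-κ * -r) (-κ) 0 (by norm_num) (by linarith)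
    (by ext; ring)
  obtain ⟨C3, h3⟩ := term (-r - 1) (-κ - 1) (-1)
    (fun u => -r * (-κ * F u) + -κ * deriv F u) (-r * -κ) (-κ) 0 (by norm_num) (by linarith)
    (by ext; ring)
  obtain ⟨C4, h4⟩ := term (-r) (-κ - 1 - 1) (-1 - 1)
    (fun u => (-κ - 1) * (-κ * F u)) ((-κ - 1) * -κ) 0 0 (by norm_num) (by linarith)
    (by ext; ring)
  obtain ⟨C5, h5⟩ := term (-r) (-κ - 1) (-1 - 1)
    (fun u => -1 * (-κ * F u)) κ 0 0 (by norm_num) (by linarith) (by ext; ring)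
  refine ⟨max 1 (max C0 (C1 + C2 + C3 + C4 + C5)), by positivity, fun t ht => ?_⟩
  have hlog : 0 < Real.log (t + 1) := Real.log_pos (by linarith)
  have ht0 : 0 < t := by linarith
  constructor
  · rw [hlam_eq t ht]
    refine (h0 t ht.le).trans ?_
    rw [add_zero]
    gcongr
    simp
  · have k1 := h1 t ht.le
    have k2 := h2 t ht.le
    have k3 := h3 t ht.le
    have k4 := h4 t ht.le
    have k5 := h5 t ht.le
    rw [show -r - 1 - 1 + 0 = -r - 2 by ring] at k1
    rw [show -r - 1 + (0 - 1) = -r - 2 by ring] at k2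
    rw [show -r - 1 + -1 = -r - 2 by ring] at k3
    rw [show -r + (-1 - 1) = -r - 2 by ring] at k4 k5
    have hC : C1 + C2 + C3 + C4 + C5 ≤ max 1 (max C0 (C1 + C2 + C3 + C4 + C5)) := by simp
    refine le_trans ?_ (mul_le_mul_of_nonneg_right hC (by positivity))
    have h6 : powLogTerm (-r - 1) (-κ) (0 - 1) (fun u => 0 * (-r * F u + deriv F u)) t = 0 := by
      simp [powLogTerm]
    rw [Filter.EventuallyEq.deriv_eq ((eventually_gt_nhds ht).mono hd1),
      ((hasDerivAt_powLogTerm ht0 fun u => ((hF1 u).const_mul (-r)).fun_add (hF2 u)).fun_add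
        (hasDerivAt_powLogTerm ht0 fun u => (hF1 u).const_mul (-κ))).deriv, h6, add_zero]
    refine (abs_add_le _ _).trans ((add_le_add (abs_add_le _ _) (abs_add_three _ _ _)).trans ?_)
    linarith

theorem deriv_deriv_even {f : ℝ → ℝ} (hf : ∀ x, f (-x) = f x) (x : ℝ) :
    deriv (deriv f) (-x) = deriv (deriv f) x := by
  have h : ∀ y, deriv f (-y) = -deriv f y := fun y => by
    rw [← neg_neg (deriv f (-y)), ← deriv_comp_neg]
    simp [hf]
  have h2 := deriv_comp_neg (deriv f) x
  simp only [h, deriv.fun_neg] at h2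
  linarith

theorem integral_indicator_abs_rpow {s m : ℝ} (hs : s < -1) (hm : 0 < m) :
    Integrable (fun x : ℝ => (Set.Ioi m).indicator (fun t => t ^ s) |x|) ∧
    ∫ x : ℝ, (Set.Ioi m).indicator (fun t => t ^ s) |x| = 2 * (-m ^ (s + 1) / (s + 1)) := by
  have h : ∫ x : ℝ, (Set.Ioi m).indicator (fun t => t ^ s) |x| = 2 * (-m ^ (s + 1) / (s + 1)) := by
    rw [integral_comp_abs (f := (Set.Ioi m).indicator (fun t => t ^ s)),
      setIntegral_indicator measurableSet_Ioi,
      Set.inter_eq_self_of_subset_right (Set.Ioi_subset_Ioi hm.le), integral_Ioi_rpow_of_lt hs hm]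
  refine ⟨Integrable.of_integral_ne_zero ?_, h⟩
  rw [h]
  have := Real.rpow_pos_of_pos hm (s + 1)
  exact mul_ne_zero two_ne_zero (div_ne_zero (by linarith) (by linarith))

/-- Bound `J_m(λ) ≤ a₄ m^{-r} (log(m+1))^{-κ}` for a mask of type `(r,κ)`, `r > 1`. -/
theorem mask_Jm_bound (r κ : ℝ) (hr : 1 < r) (lam : ℝ → ℝ)
    (hlam : IsMask r κ lam) :
    ∃ a₄ > (0 : ℝ), ∀ m : ℕ, 1 ≤ m →
      Jm lam m ≤ a₄ * (m : ℝ) ^ (-r) * (Real.log (m + 1)) ^ (-κ) := by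
  obtain ⟨C, hC, hbound⟩ := hlam.bounds
  obtain ⟨δ, hδ, hδr⟩ : ∃ δ : ℝ, 0 < δ ∧ δ < r - 1 := exists_between (by linarith)
  obtain ⟨D, hD, hlog⟩ := log_add_one_rpow_le κ hδ
  have hden : 0 < r - 1 - δ := by linarith
  refine ⟨2 * C * D * (2 / (r - 1 - δ)), by positivity, fun m hm => ?_⟩
  have hm1 : (1 : ℝ) ≤ m := by exact_mod_cast hm
  have hm0 : (0 : ℝ) < m := by linarith
  have hLm : 0 < Real.log (m + 1) := Real.log_pos (by linarith)
  set K : ℝ := 2 * C * D * ((m : ℝ) ^ (-1 - δ) * Real.log (m + 1) ^ (-κ)) with hK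
  have pointwise (t : ℝ) (ht : (m : ℝ) < t) :
      |lam t| / m + |t * deriv (deriv lam) t| ≤ K * t ^ (-r + δ) := by
    have ht0 : 0 < t := by linarith
    have hLt : 0 < Real.log (t + 1) := Real.log_pos (by linarith)
    obtain ⟨h0, h2⟩ := hbound t (by linarith)
    have hsecond : |t * deriv (deriv lam) t| ≤
        C * (t ^ (-r) * Real.log (t + 1) ^ (-κ)) / m := by
      calc |t * deriv (deriv lam) t|
          ≤ t * (C * (t ^ (-r - 2) * Real.log (t + 1) ^ (-κ))) := by
            rw [abs_mul, abs_of_pos ht0]; gcongr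
        _ = C * (t ^ (-r) * Real.log (t + 1) ^ (-κ)) / t := by
            rw [Real.rpow_sub ht0, Real.rpow_two]; field_simp
        _ ≤ _ := by gcongr
    calc |lam t| / m + |t * deriv (deriv lam) t|
        ≤ C * (t ^ (-r) * Real.log (t + 1) ^ (-κ)) / m +
          C * (t ^ (-r) * Real.log (t + 1) ^ (-κ)) / m := by gcongr
      _ = 2 * C * (t ^ (-r) * Real.log (t + 1) ^ (-κ)) / m := by ring
      _ ≤ 2 * C * (t ^ (-r) * (D * ((t / m) ^ δ * Real.log (m + 1) ^ (-κ)))) / m := by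
          gcongr
          exact hlog m t hm1 ht.le
      _ = K * t ^ (-r + δ) := by
          rw [hK, Real.rpow_add ht0, Real.div_rpow ht0.le hm0.le, Real.rpow_sub hm0,
            Real.rpow_neg_one]
          field_simp
  obtain ⟨hint, hval⟩ := integral_indicator_abs_rpow (s := -r + δ) (by linarith) hm0
  have heven (x : ℝ) : |lam x| / m + |x * deriv (deriv lam) x| =
      |lam (|x|)| / m + |(|x|) * deriv (deriv lam) (|x|)| := by
    rcases abs_choice x with h | h
    · rw [h]
    · rw [h, hlam.1, deriv_deriv_even hlam.1, neg_mul, abs_neg]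
  have hae : ∀ᵐ x : ℝ, |x| ≠ m := by
    have hfin : {x : ℝ | ¬ |x| ≠ m} ⊆ {(m : ℝ), -(m : ℝ)} := fun x hx =>
      (abs_eq hm0.le).1 (not_not.1 hx)
    exact (Set.Finite.subset (by simp) hfin).measure_zero _
  have hmeas : MeasurableSet {x : ℝ | (m : ℝ) ≤ |x|} :=
    measurableSet_le measurable_const measurable_norm
  calc Jm lam m
      ≤ ∫ x : ℝ, K * (Set.Ioi (m : ℝ)).indicator (fun t => t ^ (-r + δ)) |x| := by
        rw [Jm, ← integral_indicator hmeas]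
        refine integral_mono_of_nonneg (Filter.Eventually.of_forall fun x => ?_)
          (hint.const_mul K) ?_
        · exact Set.indicator_nonneg (fun _ _ => by positivity) x
        · filter_upwards [hae] with x hx
          by_cases hxm : (m : ℝ) ≤ |x|
          · have hlt := lt_of_le_of_ne hxm hx.symm
            rw [Set.indicator_of_mem (by exact hxm), Set.indicator_of_mem (by exact hlt), heven]
            exact pointwise _ hlt
          · rw [Set.indicator_of_notMem (by exact hxm),
              Set.indicator_of_notMem (by simpa using (not_le.1 hxm).le), mul_zero]
    _ = 2 * C * D * (2 / (r - 1 - δ)) * (m : ℝ) ^ (-r) * Real.log (m + 1) ^ (-κ) := by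
        have hpow : (m : ℝ) ^ (-1 - δ) * (m : ℝ) ^ (-r + δ + 1) = (m : ℝ) ^ (-r) := by
          rw [← Real.rpow_add hm0]; ring_nf
        have hdiv : -(m : ℝ) ^ (-r + δ + 1) / (-r + δ + 1) =
            (m : ℝ) ^ (-r + δ + 1) / (r - 1 - δ) := by
          rw [show -r + δ + 1 = -(r - 1 - δ) by ring, neg_div_neg_eq]
        rw [integral_const_mul, hval, hdiv, ← hpow, hK]
        ring
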